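/- arXiv:2304.00895 — 9 statements merged into one kernel-verified Lean document; each statement's English description precedes it below -/
import Mathlib

section
/- For every natural number n, the (n+1)-st Dedekind number equals the sum over all elements a of D n of the cardinality of the interval from a to the top element, and this in turn equals the total number of intervals of D n: d (n+1) = ∑_{a ∈ D n} Nat.card (Set.Icc a ⊤) = Nat.card {p : D n × D n // p.1 ≤ p.2}. -/
/-- `D n`: the monotone Boolean functions in `n` variables, i.e. the free
distributive lattice (with bounds) on `n` generators. -/
def D (n : ℕ) : Type := {f : (Fin n → Bool) → Bool // Monotone f}

namespace D

noncomputable instance instLattice (n : ℕ) : Lattice (D n) :=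
  Subtype.lattice (fun _ _ hf hg => hf.sup hg) (fun _ _ hf hg => hf.inf hg)

instance (n : ℕ) : DecidablePred (Monotone : ((Fin n → Bool) → Bool) → Prop) :=
  fun f => decidable_of_iff (∀ a b : Fin n → Bool, (∀ i, a i ≤ b i) → f a ≤ f b)
    (by constructor
        · intro h a b hab; exact h a b hab
        · intro h a b hab; exact h hab)

instance instFintype (n : ℕ) : Fintype (D n) := Subtype.fintype _

instance instBoundedOrder (n : ℕ) : BoundedOrder (D n) where
  top := ⟨fun _ => true, monotone_const⟩
  le_top _ := fun _ => Bool.le_true _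
  bot := ⟨fun _ => false, monotone_const⟩
  bot_le _ := fun _ => Bool.false_le _

noncomputable instance (n : ℕ) (s : Set (D n)) : Fintype s := Fintype.ofFinite _

end D

/-- The `n`-th Dedekind number. -/
noncomputable def d (n : ℕ) : ℕ := Fintype.card (D n)

noncomputable instance (n : ℕ) : Fintype {p : D n × D n // p.1 ≤ p.2} :=
  Fintype.ofFinite _

instance (n : ℕ) : DecidableEq (D n) :=
  fun a b => decidable_of_iff (a.val = b.val) Subtype.val_inj

/-- Splitting off the first variable. -/
def dSplit (n : ℕ) : D (n + 1) ≃ {p : D n × D n // p.1 ≤ p.2} where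
  toFun f := ⟨(⟨fun x => f.1 (Fin.cons false x), fun x y h => f.2 (by
        intro i
        refine Fin.cases ?_ (fun j => ?_) i
        · simp
        · simpa using h j)⟩,
      ⟨fun x => f.1 (Fin.cons true x), fun x y h => f.2 (by
        intro i
        refine Fin.cases ?_ (fun j => ?_) i
        · simp
        · simpa using h j)⟩), by
        intro x
        refine f.2 ?_
        intro i
        refine Fin.cases ?_ (fun j => ?_) i
        · simp
        · simp⟩
  invFun p := ⟨fun x => if x 0 = true then p.1.2.1 (Fin.tail x) else p.1.1.1 (Fin.tail x), by
    intro x y h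
    have h0 := h 0
    have ht : Fin.tail x ≤ Fin.tail y := fun j => h j.succ
    have hp : ∀ z, p.1.1.1 z ≤ p.1.2.1 z := p.2
    cases hx : x 0 <;> cases hy : y 0
    · simpa [hx, hy] using p.1.1.2 ht
    · simpa [hx, hy] using (p.1.1.2 ht).trans (hp _)
    · rw [hx, hy] at h0
      have h1 : (true : Bool) ≤ false := h0
      exact absurd h1 (by decide)
    · simpa [hx, hy] using p.1.2.2 ht⟩
  left_inv f := by
    apply Subtype.ext
    funext x
    have hx := Fin.cons_self_tail x
    cases h : x 0 <;> rw [h] at hx <;> simp [h, hx]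
  right_inv p := by
    apply Subtype.ext
    apply Prod.ext <;> apply Subtype.ext <;> funext x <;> simp

/-- Intervals fibred over the lower endpoint. -/
def dFib (n : ℕ) : {p : D n × D n // p.1 ≤ p.2} ≃ Σ a : D n, Set.Icc a (⊤ : D n) where
  toFun p := ⟨p.1.1, p.1.2, p.2, le_top⟩
  invFun q := ⟨(q.1, q.2.1), q.2.2.1⟩
  left_inv _ := rfl
  right_inv _ := rfl

theorem dedekind_succ_formula (n : ℕ) :
    d (n + 1) = ∑ a : D n, Nat.card (Set.Icc a ⊤) ∧
    ∑ a : D n, Nat.card (Set.Icc a ⊤) = Nat.card {p : D n × D n // p.1 ≤ p.2} := by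
  have h2 : ∑ a : D n, Nat.card (Set.Icc a ⊤) = Nat.card {p : D n × D n // p.1 ≤ p.2} := by
    rw [Nat.card_congr (dFib n), Nat.card_sigma]
  refine ⟨?_, h2⟩
  rw [h2, ← Nat.card_congr (dSplit n), d, Nat.card_eq_fintype_card]
end

section
/- For every natural number n, the (n+2)-nd Dedekind number satisfies d (n+2) = ∑_{a ∈ D n} ∑_{b ∈ D n} Nat.card (Set.Icc ⊥ (a ⊓ b)) · Nat.card (Set.Icc (a ⊔ b) ⊤). -/
def ddSlice {n : ℕ} (f : D (n + 2)) (s t : Bool) : D n :=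
  ⟨fun y => f.1 (Fin.cons s (Fin.cons t y : Fin (n + 1) → Bool) : Fin (n + 2) → Bool), by
    intro y z hyz
    apply f.2
    intro i
    refine Fin.cases ?_ (fun j => ?_) i
    · simp
    · refine Fin.cases ?_ (fun k => ?_) j
      · simp
      · simpa using hyz k⟩

theorem ddSlice_mono {n : ℕ} (f : D (n + 2)) {s t s' t' : Bool} (hs : s ≤ s') (ht : t ≤ t') :
    ddSlice f s t ≤ ddSlice f s' t' := by
  intro y
  apply f.2
  intro i
  refine Fin.cases ?_ (fun j => ?_) i
  · simpa using hs
  · refine Fin.cases ?_ (fun k => ?_) j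
    · simpa using ht
    · simp

def ddGlue {n : ℕ} (g : Bool → Bool → D n)
    (hg : ∀ s t s' t', s ≤ s' → t ≤ t' → g s t ≤ g s' t') : D (n + 2) :=
  ⟨fun w => (g (w 0) (w 1)).1 (fun i => w i.succ.succ), by
    intro w v h
    exact le_trans ((g (w 0) (w 1)).2 (fun i => h i.succ.succ))
      (hg _ _ _ _ (h 0) (h 1) (fun i => v i.succ.succ))⟩

theorem ddSlice_glue {n : ℕ} (g : Bool → Bool → D n) (hg) (s t : Bool) :
    ddSlice (ddGlue g hg) s t = g s t := by
  apply Subtype.ext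
  funext y
  rfl

theorem ddSlice_inj {n : ℕ} {f g : D (n + 2)} (h : ∀ s t, ddSlice f s t = ddSlice g s t) :
    f = g := by
  apply Subtype.ext
  funext w
  have := congrFun (congrArg Subtype.val (h (w 0) (w 1))) (fun i => w i.succ.succ)
  have hw : (Fin.cons (w 0) (Fin.cons (w 1) (fun i => w i.succ.succ) : Fin (n + 1) → Bool)
      : Fin (n + 2) → Bool) = w := by
    funext i
    refine Fin.cases ?_ (fun j => ?_) i
    · simp
    · refine Fin.cases ?_ (fun k => ?_) j
      · simp
      · simp
  simp only [ddSlice, hw] at this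
  exact this

def ddSplit {n : ℕ} (f : D (n + 2)) :
    Σ a : D n, Σ b : D n, Set.Icc (⊥ : D n) (a ⊓ b) × Set.Icc (a ⊔ b) (⊤ : D n) :=
  ⟨ddSlice f false true, ddSlice f true false,
    ⟨ddSlice f false false, bot_le, le_inf (ddSlice_mono f (by decide) (by decide))
      (ddSlice_mono f (by decide) (by decide))⟩,
    ⟨ddSlice f true true, sup_le (ddSlice_mono f (by decide) (by decide))
      (ddSlice_mono f (by decide) (by decide)), le_top⟩⟩

theorem ddSplit_bij (n : ℕ) : Function.Bijective (ddSplit (n := n)) := by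
  constructor
  · intro f g h
    have h1 := congrArg (fun p => p.1) h
    have h2 := congrArg (fun p => p.2.1) h
    have h3 := congrArg (fun p => (p.2.2.1 : D n)) h
    have h4 := congrArg (fun p => (p.2.2.2 : D n)) h
    apply ddSlice_inj
    rintro (_ | _) (_ | _)
    exacts [h3, h1, h2, h4]
  · rintro ⟨a, b, ⟨c, hc⟩, ⟨e, he⟩⟩
    have hca := hc.2.trans inf_le_left
    have hcb := hc.2.trans inf_le_right
    have hae := le_sup_left.trans he.1
    have hbe := le_sup_right.trans he.1
    have hce := hca.trans hae
    refine ⟨ddGlue (fun s t => bif s then (bif t then e else b) else (bif t then a else c)) ?_, ?_⟩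
    · rintro (_ | _) (_ | _) (_ | _) (_ | _) h1 h2 <;>
        first
        | exact absurd h1 (by decide)
        | exact absurd h2 (by decide)
        | exact le_rfl
        | assumption
    · rfl

theorem dedekind_plus_two (n : ℕ) :
    d (n + 2) =
      ∑ a : D n, ∑ b : D n,
        Nat.card (Set.Icc (⊥ : D n) (a ⊓ b)) * Nat.card (Set.Icc (a ⊔ b) (⊤ : D n)) := by
  rw [d, ← Nat.card_eq_fintype_card, Nat.card_eq_of_bijective _ (ddSplit_bij n)]
  simp only [Nat.card_sigma, Nat.card_prod]
end

section
/- For every natural number n, the (n+2)-nd Dedekind number equals the sum of the squared cardinalities of all intervals of D n: d (n+2) = ∑_{(x,y) : D n × D n, x ≤ y} (Nat.card (Set.Icc x y))². -/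
namespace D

/-- Restriction of a function on the cube by fixing the first two coordinates. -/
def slice {n : ℕ} (f : D (n + 2)) (a b : Bool) : D n :=
  ⟨fun x => f.1 (Fin.cons a (Fin.cons b x : Fin (n + 1) → Bool)), by
    intro x y h
    apply f.2
    intro i
    refine Fin.cases ?_ (fun i => ?_) i
    · exact le_rfl
    · refine Fin.cases ?_ (fun i => ?_) i
      · exact le_rfl
      · exact h i⟩

theorem slice_mono {n : ℕ} (f : D (n + 2)) {a b a' b' : Bool} (ha : a ≤ a') (hb : b ≤ b') :
    slice f a b ≤ slice f a' b' := by
  intro x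
  apply f.2
  intro i
  refine Fin.cases ?_ (fun i => ?_) i
  · exact ha
  · refine Fin.cases ?_ (fun i => ?_) i
    · exact hb
    · exact le_rfl

/-- Choose one of four functions. -/
def pick {n : ℕ} (p q r s : D n) : Bool → Bool → D n
  | false, false => p
  | false, true => r
  | true, false => s
  | true, true => q

theorem pick_mono {n : ℕ} {p q r s : D n} (h1 : p ≤ r) (h2 : r ≤ q) (h3 : p ≤ s) (h4 : s ≤ q)
    {a b a' b' : Bool} (ha : a ≤ a') (hb : b ≤ b') : pick p q r s a b ≤ pick p q r s a' b' := by
  have h5 := h1.trans h2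
  cases a <;> cases b <;> cases a' <;> cases b' <;> first
    | exact le_rfl
    | assumption
    | exact absurd ha (by decide)
    | exact absurd hb (by decide)

/-- Glue four functions together. -/
def glue {n : ℕ} (p q r s : D n) (h1 : p ≤ r) (h2 : r ≤ q) (h3 : p ≤ s) (h4 : s ≤ q) :
    D (n + 2) :=
  ⟨fun v => (pick p q r s (v 0) (v 1)).1 (fun i => v i.succ.succ), by
    intro v w h
    exact le_trans ((pick p q r s (v 0) (v 1)).2 (fun i => h i.succ.succ))
      (pick_mono h1 h2 h3 h4 (h 0) (h 1) _)⟩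

theorem slice_glue {n : ℕ} (p q r s : D n) (h1 : p ≤ r) (h2 : r ≤ q) (h3 : p ≤ s) (h4 : s ≤ q)
    (a b : Bool) : slice (glue p q r s h1 h2 h3 h4) a b = pick p q r s a b := rfl

/-- The decomposition of `D (n + 2)`. -/
def decomp (n : ℕ) : D (n + 2) ≃
    Σ p : {p : D n × D n // p.1 ≤ p.2}, Set.Icc p.val.1 p.val.2 × Set.Icc p.val.1 p.val.2 where
  toFun f := ⟨⟨(slice f false false, slice f true true),
      slice_mono f (Bool.false_le _) (Bool.false_le _)⟩,
    ⟨slice f false true, slice_mono f le_rfl (Bool.false_le _),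
      slice_mono f (Bool.false_le _) le_rfl⟩,
    ⟨slice f true false, slice_mono f (Bool.false_le _) le_rfl,
      slice_mono f le_rfl (Bool.false_le _)⟩⟩
  invFun t := glue t.1.1.1 t.1.1.2 t.2.1.1 t.2.2.1 t.2.1.2.1 t.2.1.2.2 t.2.2.2.1 t.2.2.2.2
  left_inv f := by
    apply Subtype.ext
    funext v
    have key : ∀ a b, pick (slice f false false) (slice f true true) (slice f false true)
        (slice f true false) a b = slice f a b := by
      intro a b
      cases a <;> cases b <;> rfl
    change (pick (slice f false false) (slice f true true) (slice f false true)
        (slice f true false) (v 0) (v 1)).1 (fun i => v i.succ.succ) = f.1 v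
    rw [key]
    change f.1 _ = f.1 v
    refine congrArg f.1 ?_
    funext i
    refine Fin.cases ?_ (fun i => ?_) i
    · rfl
    · refine Fin.cases ?_ (fun i => ?_) i
      · rfl
      · rfl
  right_inv t := rfl

end D

theorem dedekind_plus_two_intervals (n : ℕ) :
    d (n + 2) =
      ∑ p : {p : D n × D n // p.1 ≤ p.2}, (Nat.card (Set.Icc p.val.1 p.val.2)) ^ 2 := by
  classical
  have h := Nat.card_congr (D.decomp n)
  rw [Nat.card_sigma] at h
  rw [d, ← Nat.card_eq_fintype_card, h]
  refine Finset.sum_congr rfl (fun p _ => ?_)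
  rw [Nat.card_prod, sq]
end

section
/- For every natural number n, define square matrices α and β with rows and columns indexed by D n and natural-number entries α a b = Nat.card (Set.Icc ⊥ (a ⊓ b)) and β a b = Nat.card (Set.Icc (a ⊔ b) ⊤). Then the (n+2)-nd Dedekind number equals the trace of the matrix product: d (n+2) = Matrix.trace (α * β). -/
def dedRestr {n : ℕ} (p q : Bool) (f : D (n + 2)) : D n :=
  ⟨fun v => f.1 (Fin.cons p (Fin.cons q v : Fin (n + 1) → Bool) : Fin (n + 2) → Bool), by
    intro v w h
    apply f.2
    intro i
    refine Fin.cases ?_ (fun j => ?_) i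
    · simp
    · refine Fin.cases ?_ (fun k => ?_) j
      · simp
      · simpa using h k⟩

theorem dedRestr_mono {n : ℕ} {p q p' q' : Bool} (hp : p ≤ p') (hq : q ≤ q') (f : D (n + 2)) :
    dedRestr p q f ≤ dedRestr p' q' f := by
  intro v
  apply f.2
  intro i
  refine Fin.cases ?_ (fun j => ?_) i
  · simpa using hp
  · refine Fin.cases ?_ (fun k => ?_) j
    · simpa using hq
    · simp

def dedGlue {n : ℕ} (g : Bool → Bool → D n)
    (hg : ∀ p q p' q', p ≤ p' → q ≤ q' → g p q ≤ g p' q') : D (n + 2) :=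
  ⟨fun w => (g (w 0) (w 1)).1 (fun i => w i.succ.succ), by
    intro v w h
    exact le_trans ((g (v 0) (v 1)).2 (fun i => h i.succ.succ))
      (hg _ _ _ _ (h 0) (h 1) (fun i => w i.succ.succ))⟩

theorem dedRestr_glue {n : ℕ} (g : Bool → Bool → D n) (hg) (p q : Bool) :
    dedRestr p q (dedGlue g hg) = g p q := by
  apply Subtype.ext
  funext v
  rfl

theorem dedRestr_ext {n : ℕ} (f f' : D (n + 2))
    (h : ∀ p q, dedRestr p q f = dedRestr p q f') : f = f' := by
  apply Subtype.ext
  funext w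
  have h1 := congrFun (congrArg Subtype.val (h (w 0) (w 1))) (fun i => w i.succ.succ)
  have e : (Fin.cons (w 0) (Fin.cons (w 1) (fun i => w i.succ.succ) : Fin (n + 1) → Bool) :
      Fin (n + 2) → Bool) = w := by
    funext i
    refine Fin.cases ?_ (fun j => ?_) i
    · simp
    · refine Fin.cases ?_ (fun k => ?_) j
      · simp
      · simp
  simp only [dedRestr] at h1
  rwa [e] at h1

def dedToSigma {n : ℕ} (f : D (n + 2)) :
    Σ a : D n, Σ b : D n, Set.Icc (⊥ : D n) (a ⊓ b) × Set.Icc (a ⊔ b) (⊤ : D n) :=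
  ⟨dedRestr false true f, dedRestr true false f,
    ⟨dedRestr false false f, bot_le,
      le_inf (dedRestr_mono le_rfl (Bool.false_le _) f) (dedRestr_mono (Bool.false_le _) le_rfl f)⟩,
    ⟨dedRestr true true f,
      sup_le (dedRestr_mono (Bool.false_le _) le_rfl f) (dedRestr_mono le_rfl (Bool.false_le _) f),
      le_top⟩⟩

theorem dedToSigma_bij (n : ℕ) : Function.Bijective (dedToSigma (n := n)) := by
  constructor
  · intro f f' h
    have ha : dedRestr false true f = dedRestr false true f' := congrArg (fun s => s.1) h
    have hb : dedRestr true false f = dedRestr true false f' := congrArg (fun s => s.2.1) h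
    have hx : dedRestr false false f = dedRestr false false f' :=
      congrArg (fun s => s.2.2.1.1) h
    have hy : dedRestr true true f = dedRestr true true f' := congrArg (fun s => s.2.2.2.1) h
    apply dedRestr_ext
    intro p q
    cases p <;> cases q <;> assumption
  · rintro ⟨a, b, ⟨x, hx⟩, ⟨y, hy⟩⟩
    have hxa : x ≤ a := hx.2.trans inf_le_left
    have hxb : x ≤ b := hx.2.trans inf_le_right
    have hay : a ≤ y := le_sup_left.trans hy.1
    have hby : b ≤ y := le_sup_right.trans hy.1
    have hxy : x ≤ y := hxa.trans hay
    let g : Bool → Bool → D n := fun p q =>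
      match p, q with
      | false, false => x
      | false, true => a
      | true, false => b
      | true, true => y
    have hg : ∀ p q p' q', p ≤ p' → q ≤ q' → g p q ≤ g p' q' := by
      intro p q p' q' hp hq
      cases p <;> cases q <;> cases p' <;> cases q' <;>
        first
        | exact absurd hp (by decide)
        | exact absurd hq (by decide)
        | exact le_refl _
        | assumption
    exact ⟨dedGlue g hg, rfl⟩

theorem dedekind_plus_two_matrix (n : ℕ) :
    d (n + 2) =
      Matrix.trace
        ((Matrix.of fun a b : D n => Nat.card (Set.Icc (⊥ : D n) (a ⊓ b))) *
         (Matrix.of fun a b : D n => Nat.card (Set.Icc (a ⊔ b) (⊤ : D n)))) := by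
  have h := Nat.card_congr (Equiv.ofBijective _ (dedToSigma_bij n))
  rw [Nat.card_sigma] at h
  simp only [Nat.card_sigma, Nat.card_prod] at h
  rw [d, ← Nat.card_eq_fintype_card, h, Matrix.trace]
  refine Finset.sum_congr rfl fun a _ => ?_
  rw [Matrix.diag_apply, Matrix.mul_apply]
  refine Finset.sum_congr rfl fun b _ => ?_
  rw [Matrix.of_apply, Matrix.of_apply, sup_comm b a]
end

section
/- For every natural number n, the (n+3)-rd Dedekind number satisfies d (n+3) = ∑_{y ∈ D n} ∑_{a,b,c ∈ Set.Icc ⊥ y} Nat.card (Set.Icc ⊥ (a ⊓ b ⊓ c)) · Nat.card (Set.Icc (a ⊔ b) y) · Nat.card (Set.Icc (a ⊔ c) y) · Nat.card (Set.Icc (b ⊔ c) y), where the inner sum ranges over all triples (a, b, c) of elements of D n with a ≤ y, b ≤ y and c ≤ y. -/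
noncomputable def slice3 {n : ℕ} (f : D (n + 3)) : Bool × Bool × Bool →o D n where
  toFun p := ⟨fun x => f.1 (Fin.cons p.1 (Fin.cons p.2.1 (Fin.cons p.2.2 x) : Fin (n+2) → Bool)), by
    intro x y h
    apply f.2
    refine Fin.cons_le_cons.2 ⟨le_rfl, Fin.cons_le_cons.2 ⟨le_rfl, Fin.cons_le_cons.2 ⟨le_rfl, h⟩⟩⟩⟩
  monotone' := by
    intro p q h x
    apply f.2
    exact Fin.cons_le_cons.2 ⟨h.1, Fin.cons_le_cons.2 ⟨h.2.1, Fin.cons_le_cons.2 ⟨h.2.2, le_rfl⟩⟩⟩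

noncomputable def sliceEquiv (n : ℕ) : D (n + 3) ≃ (Bool × Bool × Bool →o D n) where
  toFun := slice3
  invFun g := ⟨fun x => (g (x 0, Fin.tail x 0, Fin.tail (Fin.tail x) 0)).1
      (Fin.tail (Fin.tail (Fin.tail x))), by
    intro x y h
    have h1 : (g (x 0, Fin.tail x 0, Fin.tail (Fin.tail x) 0)) ≤
      (g (y 0, Fin.tail y 0, Fin.tail (Fin.tail y) 0)) :=
      g.monotone ⟨h _, h _, h _⟩
    exact (h1 _).trans ((g (y 0, Fin.tail y 0, Fin.tail (Fin.tail y) 0)).2 (fun i => h _))⟩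
  left_inv f := by
    apply Subtype.ext
    funext x
    change f.1 (Fin.cons (x 0) (Fin.cons (Fin.tail x 0) (Fin.cons (Fin.tail (Fin.tail x) 0)
      (Fin.tail (Fin.tail (Fin.tail x)))) : Fin (n+2) → Bool)) = f.1 x
    simp only [Fin.cons_self_tail]
  right_inv g := by
    ext p : 2
    apply Subtype.ext
    funext x
    rfl

abbrev Sg (L : Type) [Lattice L] [BoundedOrder L] : Type :=
  Σ y : L, Σ a : Set.Icc (⊥ : L) y, Σ b : Set.Icc (⊥ : L) y, Σ c : Set.Icc (⊥ : L) y,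
    ((Set.Icc (⊥ : L) ((a : L) ⊓ b ⊓ c) × Set.Icc ((a : L) ⊔ b) y) × Set.Icc ((a : L) ⊔ c) y)
      × Set.Icc ((b : L) ⊔ c) y

noncomputable def cubeEquiv (L : Type) [Lattice L] [BoundedOrder L] : (Bool × Bool × Bool →o L) ≃ Sg L where
  toFun g := ⟨g (true, true, true), ⟨g (true, false, false), bot_le, g.monotone (by decide)⟩,
    ⟨g (false, true, false), bot_le, g.monotone (by decide)⟩,
    ⟨g (false, false, true), bot_le, g.monotone (by decide)⟩,
    ((⟨g (false, false, false), bot_le, le_inf (le_inf (g.monotone (by decide))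
        (g.monotone (by decide))) (g.monotone (by decide))⟩,
     ⟨g (true, true, false), sup_le (g.monotone (by decide)) (g.monotone (by decide)),
        g.monotone (by decide)⟩),
     ⟨g (true, false, true), sup_le (g.monotone (by decide)) (g.monotone (by decide)),
        g.monotone (by decide)⟩),
     ⟨g (false, true, true), sup_le (g.monotone (by decide)) (g.monotone (by decide)),
        g.monotone (by decide)⟩⟩
  invFun s :=
    { toFun := fun p => match p with
        | (true, true, true) => s.1
        | (true, false, false) => s.2.1
        | (false, true, false) => s.2.2.1
        | (false, false, true) => s.2.2.2.1
        | (false, false, false) => s.2.2.2.2.1.1.1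
        | (true, true, false) => s.2.2.2.2.1.1.2
        | (true, false, true) => s.2.2.2.2.1.2
        | (false, true, true) => s.2.2.2.2.2
      monotone' := by
        obtain ⟨y, ⟨a, ha0, ha⟩, ⟨b, hb0, hb⟩, ⟨c, hc0, hc⟩,
          ⟨⟨⟨z, hz0, hz⟩, ⟨u, hu0, hu⟩⟩, ⟨v, hv0, hv⟩⟩, ⟨w, hw0, hw⟩⟩ := s
        simp only [le_inf_iff, sup_le_iff] at hz hu0 hv0 hw0
        obtain ⟨⟨hza, hzb⟩, hzc⟩ := hz
        have e1 := hza.trans ha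
        have e2 := hza.trans hu0.1
        have e3 := hza.trans hv0.1
        have e4 := hzb.trans hw0.1
        rintro ⟨p1, p2, p3⟩ ⟨q1, q2, q3⟩ h
        cases p1 <;> cases p2 <;> cases p3 <;> cases q1 <;> cases q2 <;> cases q3 <;>
          first
          | exact absurd h (by decide)
          | exact le_rfl
          | assumption
          | exact hu0.1
          | exact hu0.2
          | exact hv0.1
          | exact hv0.2
          | exact hw0.1
          | exact hw0.2 }
  left_inv g := by
    ext ⟨p1, p2, p3⟩
    cases p1 <;> cases p2 <;> cases p3 <;> rfl
  right_inv s := rfl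


theorem dedekind_plus_three (n : ℕ) :
    d (n + 3) =
      ∑ y : D n, ∑ a : Set.Icc (⊥ : D n) y, ∑ b : Set.Icc (⊥ : D n) y, ∑ c : Set.Icc (⊥ : D n) y,
        Nat.card (Set.Icc (⊥ : D n) ((a : D n) ⊓ b ⊓ c)) *
        Nat.card (Set.Icc ((a : D n) ⊔ b) y) *
        Nat.card (Set.Icc ((a : D n) ⊔ c) y) *
        Nat.card (Set.Icc ((b : D n) ⊔ c) y) := by

  have h : d (n + 3) = Nat.card (Sg (D n)) := by
    rw [d, ← Nat.card_eq_fintype_card]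
    exact Nat.card_congr ((sliceEquiv n).trans (cubeEquiv (D n)))
  rw [h]
  simp only [Sg, Nat.card_sigma, Nat.card_prod]
end

section
/- For every natural number n, the (n+3)-rd Dedekind number satisfies d (n+3) = ∑_{(x,y) : D n × D n, x ≤ y} ∑_{a,b,c ∈ Set.Icc x y} Nat.card (Set.Icc (a ⊔ b) y) · Nat.card (Set.Icc (a ⊔ c) y) · Nat.card (Set.Icc (b ⊔ c) y), where the outer sum ranges over all intervals [x, y] of D n and the inner sum over all triples (a, b, c) of elements of the interval. -/
abbrev SigT (n : ℕ) : Type :=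
  Σ p : {p : D n × D n // p.1 ≤ p.2}, Σ a : Set.Icc p.val.1 p.val.2,
    Σ b : Set.Icc p.val.1 p.val.2, Σ c : Set.Icc p.val.1 p.val.2,
      (Set.Icc ((a : D n) ⊔ b) p.val.2 × Set.Icc ((a : D n) ⊔ c) p.val.2) ×
        Set.Icc ((b : D n) ⊔ c) p.val.2

def pt {n : ℕ} (t : Bool × Bool × Bool) (x : Fin n → Bool) : Fin (n + 3) → Bool :=
  Fin.cons t.1 (Fin.cons t.2.1 (Fin.cons t.2.2 x : Fin (n + 1) → Bool) : Fin (n + 2) → Bool)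

def hd {n : ℕ} (z : Fin (n + 3) → Bool) : Bool × Bool × Bool :=
  (z 0, Fin.tail z 0, Fin.tail (Fin.tail z) 0)

def tl {n : ℕ} (z : Fin (n + 3) → Bool) : Fin n → Bool := Fin.tail (Fin.tail (Fin.tail z))

theorem pt_hd_tl {n : ℕ} (z : Fin (n + 3) → Bool) : pt (hd z) (tl z) = z := by
  simp [pt, hd, tl, Fin.cons_self_tail]

theorem hd_pt {n : ℕ} (t) (x : Fin n → Bool) : hd (pt t x) = t := by
  simp [pt, hd, Fin.tail_cons]

theorem tl_pt {n : ℕ} (t) (x : Fin n → Bool) : tl (pt t x) = x := by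
  simp [pt, tl, Fin.tail_cons]

theorem pt_mono {n : ℕ} {s t : Bool × Bool × Bool} {x y : Fin n → Bool} (h : s ≤ t)
    (h' : x ≤ y) : pt s x ≤ pt t y := by
  refine Fin.cons_le_cons.2 ⟨h.1, Fin.cons_le_cons.2 ⟨h.2.1, Fin.cons_le_cons.2 ⟨h.2.2, h'⟩⟩⟩

theorem hd_mono {n : ℕ} : Monotone (hd (n := n)) :=
  fun _ _ h => ⟨h _, h _, h _⟩

theorem tl_mono {n : ℕ} : Monotone (tl (n := n)) :=
  fun _ _ h _ => h _

noncomputable def eqv1 (n : ℕ) : D (n + 3) ≃ {F : Bool × Bool × Bool → D n // Monotone F} where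
  toFun f := ⟨fun t => ⟨fun x => f.1 (pt t x), fun _ _ h => f.2 (pt_mono le_rfl h)⟩,
    fun _ _ h _ => f.2 (pt_mono h le_rfl)⟩
  invFun F := ⟨fun z => (F.1 (hd z)).1 (tl z), fun _ _ h =>
    le_trans ((F.1 _).2 (tl_mono h)) (F.2 (hd_mono h) _)⟩
  left_inv f := Subtype.ext (funext fun z => by simp only [pt_hd_tl])
  right_inv F := Subtype.ext (funext fun t => Subtype.ext (funext fun x => by
    simp only [hd_pt, tl_pt]))

def mk8 {α : Type} (x a b c ab ac bc y : α) : Bool × Bool × Bool → α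
  | (false, false, false) => x
  | (true, false, false) => a
  | (false, true, false) => b
  | (false, false, true) => c
  | (true, true, false) => ab
  | (true, false, true) => ac
  | (false, true, true) => bc
  | (true, true, true) => y

theorem mk8_mono {α : Type} [Lattice α] {x a b c ab ac bc y : α}
    (h1 : x ≤ a) (h2 : x ≤ b) (h3 : x ≤ c)
    (h4 : a ⊔ b ≤ ab) (h5 : a ⊔ c ≤ ac) (h6 : b ⊔ c ≤ bc)
    (h7 : ab ≤ y) (h8 : ac ≤ y) (h9 : bc ≤ y) : Monotone (mk8 x a b c ab ac bc y) := by
  rw [sup_le_iff] at h4 h5 h6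
  obtain ⟨h4, h4'⟩ := h4
  obtain ⟨h5, h5'⟩ := h5
  obtain ⟨h6, h6'⟩ := h6
  rintro ⟨_ | _, _ | _, _ | _⟩ ⟨_ | _, _ | _, _ | _⟩ h <;>
    first
    | (exfalso; revert h; decide)
    | (simp only [mk8]; order)

noncomputable def eqv2 (n : ℕ) : {F : Bool × Bool × Bool → D n // Monotone F} ≃ SigT n where
  toFun F :=
    ⟨⟨(F.1 (false, false, false), F.1 (true, true, true)), F.2 (by decide)⟩,
     ⟨F.1 (true, false, false), F.2 (by decide), F.2 (by decide)⟩,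
     ⟨F.1 (false, true, false), F.2 (by decide), F.2 (by decide)⟩,
     ⟨F.1 (false, false, true), F.2 (by decide), F.2 (by decide)⟩,
     (⟨F.1 (true, true, false), sup_le (F.2 (by decide)) (F.2 (by decide)), F.2 (by decide)⟩,
      ⟨F.1 (true, false, true), sup_le (F.2 (by decide)) (F.2 (by decide)), F.2 (by decide)⟩),
      ⟨F.1 (false, true, true), sup_le (F.2 (by decide)) (F.2 (by decide)), F.2 (by decide)⟩⟩
  invFun s :=
    match s with
    | ⟨p, a, b, c, (ab, ac), bc⟩ =>
      ⟨mk8 p.1.1 a.1 b.1 c.1 ab.1 ac.1 bc.1 p.1.2,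
        mk8_mono a.2.1 b.2.1 c.2.1 ab.2.1 ac.2.1 bc.2.1 ab.2.2 ac.2.2 bc.2.2⟩
  left_inv F := Subtype.ext (funext fun t => by
    rcases t with ⟨_ | _, _ | _, _ | _⟩ <;> rfl)
  right_inv s := by
    rcases s with ⟨p, a, b, c, ⟨ab, ac⟩, bc⟩
    rfl

theorem dedekind_plus_three_intervals (n : ℕ) :
    d (n + 3) =
      ∑ p : {p : D n × D n // p.1 ≤ p.2},
        ∑ a : Set.Icc p.val.1 p.val.2, ∑ b : Set.Icc p.val.1 p.val.2, ∑ c : Set.Icc p.val.1 p.val.2,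
          Nat.card (Set.Icc ((a : D n) ⊔ b) p.val.2) *
          Nat.card (Set.Icc ((a : D n) ⊔ c) p.val.2) *
          Nat.card (Set.Icc ((b : D n) ⊔ c) p.val.2) := by
  have e : d (n + 3) = Nat.card (SigT n) := by
    rw [d, ← Nat.card_eq_fintype_card]
    exact Nat.card_congr ((eqv1 n).trans (eqv2 n))
  rw [e]
  simp only [SigT, Nat.card_sigma, Nat.card_prod]
end

section
/- For every natural number n, the (n+4)-th Dedekind number satisfies d (n+4) = ∑_{(x,y) : D n × D n, x ≤ y} X(x,y), where X(x,y) = ∑_{a,b,c,d ∈ Set.Icc x y} ∑_{e ∈ Set.Icc (a⊔b) y} ∑_{f ∈ Set.Icc (a⊔c) y} ∑_{g ∈ Set.Icc (a⊔d) y} ∑_{h ∈ Set.Icc (b⊔c) y} ∑_{i ∈ Set.Icc (b⊔d) y} ∑_{j ∈ Set.Icc (c⊔d) y} Nat.card (Set.Icc (e⊔f⊔h) y) · Nat.card (Set.Icc (e⊔g⊔i) y) · Nat.card (Set.Icc (f⊔g⊔j) y) · Nat.card (Set.Icc (h⊔i⊔j) y). -/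
/-- Monotone maps from the four-dimensional cube to `D n`, curried. -/
def Cube (n : ℕ) : Type :=
  {F : Bool → Bool → Bool → Bool → D n //
    (∀ q r s, F false q r s ≤ F true q r s) ∧ (∀ p r s, F p false r s ≤ F p true r s) ∧
    (∀ p q s, F p q false s ≤ F p q true s) ∧ (∀ p q r, F p q r false ≤ F p q r true)}

theorem cube_mono {n : ℕ} (F : Cube n) {p q r s p' q' r' s' : Bool}
    (hp : p ≤ p') (hq : q ≤ q') (hr : r ≤ r') (hs : s ≤ s') :
    F.1 p q r s ≤ F.1 p' q' r' s' := by
  obtain ⟨F, h1, h2, h3, h4⟩ := F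
  have e1 : F p q r s ≤ F p' q r s := by
    cases p <;> cases p' <;> first | exact le_rfl | exact h1 _ _ _ | exact absurd hp (by decide)
  have e2 : F p' q r s ≤ F p' q' r s := by
    cases q <;> cases q' <;> first | exact le_rfl | exact h2 _ _ _ | exact absurd hq (by decide)
  have e3 : F p' q' r s ≤ F p' q' r' s := by
    cases r <;> cases r' <;> first | exact le_rfl | exact h3 _ _ _ | exact absurd hr (by decide)
  have e4 : F p' q' r' s ≤ F p' q' r' s' := by
    cases s <;> cases s' <;> first | exact le_rfl | exact h4 _ _ _ | exact absurd hs (by decide)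
  exact e1.trans (e2.trans (e3.trans e4))

theorem append_mono {n : ℕ} {v v' : Fin n → Bool} {w w' : Fin 4 → Bool}
    (hv : v ≤ v') (hw : w ≤ w') : Fin.append v w ≤ Fin.append v' w' := by
  intro i
  refine Fin.addCases (fun j => ?_) (fun j => ?_) i
  · simpa using hv j
  · simpa using hw j

theorem vec_mono {p q r s p' q' r' s' : Bool}
    (hp : p ≤ p') (hq : q ≤ q') (hr : r ≤ r') (hs : s ≤ s') :
    (![p, q, r, s] : Fin 4 → Bool) ≤ ![p', q', r', s'] := by
  intro i
  fin_cases i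
  · exact hp
  · exact hq
  · exact hr
  · exact hs

def equivCube (n : ℕ) : D (n + 4) ≃ Cube n where
  toFun f := ⟨fun p q r s => ⟨fun v => f.1 (Fin.append v ![p, q, r, s]),
      fun _ _ h => f.2 (append_mono h le_rfl)⟩,
    fun _ _ _ _ => f.2 (append_mono le_rfl (vec_mono (Bool.false_le _) le_rfl le_rfl le_rfl)),
    fun _ _ _ _ => f.2 (append_mono le_rfl (vec_mono le_rfl (Bool.false_le _) le_rfl le_rfl)),
    fun _ _ _ _ => f.2 (append_mono le_rfl (vec_mono le_rfl le_rfl (Bool.false_le _) le_rfl)),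
    fun _ _ _ _ => f.2 (append_mono le_rfl (vec_mono le_rfl le_rfl le_rfl (Bool.false_le _)))⟩
  invFun F := ⟨fun w => (F.1 (w (Fin.natAdd n 0)) (w (Fin.natAdd n 1)) (w (Fin.natAdd n 2))
      (w (Fin.natAdd n 3))).1 (fun i => w (Fin.castAdd 4 i)), fun w w' h =>
    le_trans ((F.1 _ _ _ _).2 (fun i => h (Fin.castAdd 4 i)))
      (cube_mono F (h _) (h _) (h _) (h _) _)⟩
  left_inv f := by
    apply Subtype.ext
    funext w
    refine congrArg f.1 ?_
    funext i
    refine Fin.addCases (fun j => ?_) (fun j => ?_) i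
    · simp
    · rw [Fin.append_right]
      fin_cases j <;> rfl
  right_inv F := by
    apply Subtype.ext
    funext p q r s
    apply Subtype.ext
    funext v
    simp only [Fin.append_right, Fin.append_left]
    rfl

abbrev Sig (n : ℕ) : Type :=
  Σ p : {p : D n × D n // p.1 ≤ p.2},
  Σ a : Set.Icc p.val.1 p.val.2, Σ b : Set.Icc p.val.1 p.val.2,
  Σ c : Set.Icc p.val.1 p.val.2, Σ dd : Set.Icc p.val.1 p.val.2,
  Σ e : Set.Icc ((a : D n) ⊔ b) p.val.2,
  Σ f : Set.Icc ((a : D n) ⊔ c) p.val.2,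
  Σ g : Set.Icc ((a : D n) ⊔ dd) p.val.2,
  Σ h : Set.Icc ((b : D n) ⊔ c) p.val.2,
  Σ i : Set.Icc ((b : D n) ⊔ dd) p.val.2,
  Σ j : Set.Icc ((c : D n) ⊔ dd) p.val.2,
    ((Set.Icc ((e : D n) ⊔ f ⊔ h) p.val.2 ×
    Set.Icc ((e : D n) ⊔ g ⊔ i) p.val.2) ×
    Set.Icc ((f : D n) ⊔ g ⊔ j) p.val.2) ×
    Set.Icc ((h : D n) ⊔ i ⊔ j) p.val.2

/-- The sixteen values of a map on the cube. -/
def tab {α : Type} (x a b c d e f g h i j k l m o y : α) : Bool → Bool → Bool → Bool → α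
  | false, false, false, false => x
  | true, false, false, false => a
  | false, true, false, false => b
  | false, false, true, false => c
  | false, false, false, true => d
  | true, true, false, false => e
  | true, false, true, false => f
  | true, false, false, true => g
  | false, true, true, false => h
  | false, true, false, true => i
  | false, false, true, true => j
  | true, true, true, false => k
  | true, true, false, true => l
  | true, false, true, true => m
  | false, true, true, true => o
  | true, true, true, true => y

def ofSig {n : ℕ} : Sig n → Cube n
  | ⟨⟨(x, y), _⟩, ⟨a, ha⟩, ⟨b, hb⟩, ⟨c, hc⟩, ⟨d, hd⟩, ⟨e, he⟩, ⟨f, hf⟩, ⟨g, hg⟩, ⟨h, hh⟩,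
      ⟨i, hi⟩, ⟨j, hj⟩, ((⟨k, hk⟩, ⟨l, hl⟩), ⟨m, hm⟩), ⟨o, ho⟩⟩ =>
    ⟨tab x a b c d e f g h i j k l m o y, by
      have t1 := And.intro ha (And.intro hb (And.intro hc hd))
      have t2 := And.intro he (And.intro hf (And.intro hg (And.intro hh (And.intro hi hj))))
      have t3 := And.intro hk (And.intro hl (And.intro hm ho))
      clear hk hl hm ho
      simp only [Set.mem_Icc, sup_le_iff] at t1 t2 t3
      obtain ⟨⟨_, _⟩, ⟨_, _⟩, ⟨_, _⟩, ⟨_, _⟩⟩ := t1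
      obtain ⟨⟨⟨_, _⟩, _⟩, ⟨⟨_, _⟩, _⟩, ⟨⟨_, _⟩, _⟩, ⟨⟨_, _⟩, _⟩, ⟨⟨_, _⟩, _⟩, ⟨⟨_, _⟩, _⟩⟩ := t2
      obtain ⟨⟨⟨⟨_, _⟩, _⟩, _⟩, ⟨⟨⟨_, _⟩, _⟩, _⟩, ⟨⟨⟨_, _⟩, _⟩, _⟩, ⟨⟨⟨_, _⟩, _⟩, _⟩⟩ := t3
      refine ⟨?_, ?_, ?_, ?_⟩ <;> rintro (_ | _) (_ | _) (_ | _) <;> simp only [tab] <;> assumption⟩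

def toSig {n : ℕ} (F : Cube n) : Sig n :=
  have M : ∀ p q r s p' q' r' s', p ≤ p' → q ≤ q' → r ≤ r' → s ≤ s' →
    F.1 p q r s ≤ F.1 p' q' r' s' := fun _ _ _ _ _ _ _ _ hp hq hr hs => cube_mono F hp hq hr hs
  ⟨⟨(F.1 false false false false, F.1 true true true true), by apply M <;> decide⟩,
  ⟨F.1 true false false false, ⟨by apply M <;> decide, by apply M <;> decide⟩⟩,
  ⟨F.1 false true false false, ⟨by apply M <;> decide, by apply M <;> decide⟩⟩,
  ⟨F.1 false false true false, ⟨by apply M <;> decide, by apply M <;> decide⟩⟩,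
  ⟨F.1 false false false true, ⟨by apply M <;> decide, by apply M <;> decide⟩⟩,
  ⟨F.1 true true false false, ⟨sup_le (by apply M <;> decide) (by apply M <;> decide), by apply M <;> decide⟩⟩,
  ⟨F.1 true false true false, ⟨sup_le (by apply M <;> decide) (by apply M <;> decide), by apply M <;> decide⟩⟩,
  ⟨F.1 true false false true, ⟨sup_le (by apply M <;> decide) (by apply M <;> decide), by apply M <;> decide⟩⟩,
  ⟨F.1 false true true false, ⟨sup_le (by apply M <;> decide) (by apply M <;> decide), by apply M <;> decide⟩⟩,
  ⟨F.1 false true false true, ⟨sup_le (by apply M <;> decide) (by apply M <;> decide), by apply M <;> decide⟩⟩,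
  ⟨F.1 false false true true, ⟨sup_le (by apply M <;> decide) (by apply M <;> decide), by apply M <;> decide⟩⟩,
  (((⟨F.1 true true true false, ⟨sup_le (sup_le (by apply M <;> decide) (by apply M <;> decide))
      (by apply M <;> decide), by apply M <;> decide⟩⟩,
    ⟨F.1 true true false true, ⟨sup_le (sup_le (by apply M <;> decide) (by apply M <;> decide))
      (by apply M <;> decide), by apply M <;> decide⟩⟩),
    ⟨F.1 true false true true, ⟨sup_le (sup_le (by apply M <;> decide) (by apply M <;> decide))
      (by apply M <;> decide), by apply M <;> decide⟩⟩),
    ⟨F.1 false true true true, ⟨sup_le (sup_le (by apply M <;> decide) (by apply M <;> decide))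
      (by apply M <;> decide), by apply M <;> decide⟩⟩)⟩

theorem toSig_ofSig {n : ℕ} (z : Sig n) : toSig (ofSig z) = z := by
  obtain ⟨⟨⟨x, y⟩, _⟩, ⟨a, ha⟩, ⟨b, hb⟩, ⟨c, hc⟩, ⟨d, hd⟩, ⟨e, he⟩, ⟨f, hf⟩, ⟨g, hg⟩, ⟨h, hh⟩,
      ⟨i, hi⟩, ⟨j, hj⟩, ⟨⟨⟨k, hk⟩, ⟨l, hl⟩⟩, ⟨m, hm⟩⟩, ⟨o, ho⟩⟩ := z
  rfl

theorem ofSig_toSig {n : ℕ} (F : Cube n) : ofSig (toSig F) = F := by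
  apply Subtype.ext
  funext p q r s
  cases p <;> cases q <;> cases r <;> cases s <;> rfl

theorem dedekind_plus_four (n : ℕ) :
    d (n + 4) =
      ∑ p : {p : D n × D n // p.1 ≤ p.2},
        ∑ a : Set.Icc p.val.1 p.val.2, ∑ b : Set.Icc p.val.1 p.val.2,
        ∑ c : Set.Icc p.val.1 p.val.2, ∑ dd : Set.Icc p.val.1 p.val.2,
          ∑ e : Set.Icc ((a : D n) ⊔ b) p.val.2,
          ∑ f : Set.Icc ((a : D n) ⊔ c) p.val.2,
          ∑ g : Set.Icc ((a : D n) ⊔ dd) p.val.2,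
          ∑ h : Set.Icc ((b : D n) ⊔ c) p.val.2,
          ∑ i : Set.Icc ((b : D n) ⊔ dd) p.val.2,
          ∑ j : Set.Icc ((c : D n) ⊔ dd) p.val.2,
            Nat.card (Set.Icc ((e : D n) ⊔ f ⊔ h) p.val.2) *
            Nat.card (Set.Icc ((e : D n) ⊔ g ⊔ i) p.val.2) *
            Nat.card (Set.Icc ((f : D n) ⊔ g ⊔ j) p.val.2) *
            Nat.card (Set.Icc ((h : D n) ⊔ i ⊔ j) p.val.2) := by
  have h1 : d (n + 4) = Nat.card (Sig n) := by
    rw [d, ← Nat.card_eq_fintype_card]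
    exact Nat.card_congr ((equivCube n).trans ⟨toSig, ofSig, ofSig_toSig, toSig_ofSig⟩)
  rw [h1]
  simp only [Sig, Nat.card_sigma, Nat.card_prod]
end

section
/- For every natural number n, the (n+4)-th Dedekind number satisfies d (n+4) = ∑_{(x,y) : D n × D n, x ≤ y} X(x,y), where X(x,y) = ∑_{a,b,c,d ∈ Set.Icc x y} ∑_{e ∈ Set.Icc (a⊔b⊔c) y} ∑_{f ∈ Set.Icc (a⊔b⊔d) y} ∑_{g ∈ Set.Icc (a⊔c⊔d) y} ∑_{h ∈ Set.Icc (b⊔c⊔d) y} Nat.card (Set.Icc (a⊔b) (e⊓f)) · Nat.card (Set.Icc (a⊔c) (e⊓g)) · Nat.card (Set.Icc (a⊔d) (f⊓g)) · Nat.card (Set.Icc (b⊔c) (e⊓h)) · Nat.card (Set.Icc (b⊔d) (f⊓h)) · Nat.card (Set.Icc (c⊔d) (g⊓h)). -/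
def DedM (n : ℕ) : Type := {F : Bool → Bool → Bool → Bool → D n //
  (∀ b c e, F false b c e ≤ F true b c e) ∧ (∀ a c e, F a false c e ≤ F a true c e) ∧
  (∀ a b e, F a b false e ≤ F a b true e) ∧ (∀ a b c, F a b c false ≤ F a b c true)}

theorem DedM.mono {n : ℕ} (F : DedM n) {a a' b b' c c' e e' : Bool}
    (ha : a ≤ a') (hb : b ≤ b') (hc : c ≤ c') (he : e ≤ e') :
    F.1 a b c e ≤ F.1 a' b' c' e' := by
  obtain ⟨F, h1, h2, h3, h4⟩ := F
  have k1 : F a b c e ≤ F a' b c e := by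
    revert ha; cases a <;> cases a' <;> simp [h1]
  have k2 : F a' b c e ≤ F a' b' c e := by
    revert hb; cases b <;> cases b' <;> simp [h2]
  have k3 : F a' b' c e ≤ F a' b' c' e := by
    revert hc; cases c <;> cases c' <;> simp [h3]
  have k4 : F a' b' c' e ≤ F a' b' c' e' := by
    revert he; cases e <;> cases e' <;> simp [h4]
  exact k1.trans (k2.trans (k3.trans k4))

def consFour {n : ℕ} (a b c e : Bool) (v : Fin n → Bool) : Fin (n + 4) → Bool :=
  Fin.cons a (Fin.cons b (Fin.cons c (Fin.cons e v : Fin (n+1) → Bool) : Fin (n+2) → Bool)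
    : Fin (n+3) → Bool)

theorem consFour_mono {n : ℕ} {a a' b b' c c' e e' : Bool} {v v' : Fin n → Bool}
    (ha : a ≤ a') (hb : b ≤ b') (hc : c ≤ c') (he : e ≤ e') (hv : v ≤ v') :
    consFour a b c e v ≤ consFour a' b' c' e' v' := by
  unfold consFour
  refine Fin.cons_le_cons.2 ⟨ha, Fin.cons_le_cons.2 ⟨hb, Fin.cons_le_cons.2 ⟨hc,
    Fin.cons_le_cons.2 ⟨he, hv⟩⟩⟩⟩

theorem consFour_eta {n : ℕ} (v : Fin (n+4) → Bool) :
    consFour (v 0) (v (Fin.succ 0)) (v (Fin.succ (Fin.succ 0)))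
      (v (Fin.succ (Fin.succ (Fin.succ 0)))) (fun i => v i.succ.succ.succ.succ) = v := by
  unfold consFour
  funext i
  refine Fin.cases rfl (fun i => ?_) i
  refine Fin.cases rfl (fun i => ?_) i
  refine Fin.cases rfl (fun i => ?_) i
  refine Fin.cases rfl (fun i => ?_) i
  rfl

def dedEquivM (n : ℕ) : D (n + 4) ≃ DedM n where
  toFun f := ⟨fun a b c e => ⟨fun v => f.1 (consFour a b c e v), fun _ _ h =>
      f.2 (consFour_mono le_rfl le_rfl le_rfl le_rfl h)⟩,
    fun _ _ _ _ => f.2 (consFour_mono (Bool.false_le _) le_rfl le_rfl le_rfl le_rfl),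
    fun _ _ _ _ => f.2 (consFour_mono le_rfl (Bool.false_le _) le_rfl le_rfl le_rfl),
    fun _ _ _ _ => f.2 (consFour_mono le_rfl le_rfl (Bool.false_le _) le_rfl le_rfl),
    fun _ _ _ _ => f.2 (consFour_mono le_rfl le_rfl le_rfl (Bool.false_le _) le_rfl)⟩
  invFun F := ⟨fun v => (F.1 (v 0) (v (Fin.succ 0)) (v (Fin.succ (Fin.succ 0)))
      (v (Fin.succ (Fin.succ (Fin.succ 0))))).1 (fun i => v i.succ.succ.succ.succ),
    fun v w h => ((F.1 _ _ _ _).2 (fun i => h _)).trans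
      (F.mono (h _) (h _) (h _) (h _) _)⟩
  left_inv f := Subtype.ext (funext fun v => congrArg f.1 (consFour_eta v))
  right_inv F := rfl

abbrev DedS (n : ℕ) : Type :=
  Σ p : {p : D n × D n // p.1 ≤ p.2},
  Σ a : Set.Icc p.val.1 p.val.2, Σ b : Set.Icc p.val.1 p.val.2,
  Σ c : Set.Icc p.val.1 p.val.2, Σ dd : Set.Icc p.val.1 p.val.2,
  Σ e : Set.Icc ((a : D n) ⊔ b ⊔ c) p.val.2,
  Σ f : Set.Icc ((a : D n) ⊔ b ⊔ dd) p.val.2,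
  Σ g : Set.Icc ((a : D n) ⊔ c ⊔ dd) p.val.2,
  Σ h : Set.Icc ((b : D n) ⊔ c ⊔ dd) p.val.2,
    ((((Set.Icc ((a : D n) ⊔ b) ((e : D n) ⊓ f) ×
    Set.Icc ((a : D n) ⊔ c) ((e : D n) ⊓ g)) ×
    Set.Icc ((a : D n) ⊔ dd) ((f : D n) ⊓ g)) ×
    Set.Icc ((b : D n) ⊔ c) ((e : D n) ⊓ h)) ×
    Set.Icc ((b : D n) ⊔ dd) ((f : D n) ⊓ h)) ×
    Set.Icc ((c : D n) ⊔ dd) ((g : D n) ⊓ h)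

def pick {α : Type} (x a b c e ab ac ae bc be ce abc abe ace bce y : α) :
    Bool → Bool → Bool → Bool → α
  | false, false, false, false => x
  | true, false, false, false => a
  | false, true, false, false => b
  | false, false, true, false => c
  | false, false, false, true => e
  | true, true, false, false => ab
  | true, false, true, false => ac
  | true, false, false, true => ae
  | false, true, true, false => bc
  | false, true, false, true => be
  | false, false, true, true => ce
  | true, true, true, false => abc
  | true, true, false, true => abe
  | true, false, true, true => ace
  | false, true, true, true => bce
  | true, true, true, true => y

def dedMEquivS (n : ℕ) : DedM n ≃ DedS n where
  toFun F :=
    have m {a b c e a' b' c' e' : Bool} (h : a ≤ a' ∧ b ≤ b' ∧ c ≤ c' ∧ e ≤ e') :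
        F.1 a b c e ≤ F.1 a' b' c' e' := F.mono h.1 h.2.1 h.2.2.1 h.2.2.2
    let t := true
    let o := false
    ⟨⟨(F.1 o o o o, F.1 t t t t), m (by decide)⟩,
     ⟨F.1 t o o o, m (by decide), m (by decide)⟩,
     ⟨F.1 o t o o, m (by decide), m (by decide)⟩,
     ⟨F.1 o o t o, m (by decide), m (by decide)⟩,
     ⟨F.1 o o o t, m (by decide), m (by decide)⟩,
     ⟨F.1 t t t o, sup_le (sup_le (m (by decide)) (m (by decide))) (m (by decide)), m (by decide)⟩,
     ⟨F.1 t t o t, sup_le (sup_le (m (by decide)) (m (by decide))) (m (by decide)), m (by decide)⟩,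
     ⟨F.1 t o t t, sup_le (sup_le (m (by decide)) (m (by decide))) (m (by decide)), m (by decide)⟩,
     ⟨F.1 o t t t, sup_le (sup_le (m (by decide)) (m (by decide))) (m (by decide)), m (by decide)⟩,
     (((((⟨F.1 t t o o, sup_le (m (by decide)) (m (by decide)), le_inf (m (by decide)) (m (by decide))⟩,
     ⟨F.1 t o t o, sup_le (m (by decide)) (m (by decide)), le_inf (m (by decide)) (m (by decide))⟩),
     ⟨F.1 t o o t, sup_le (m (by decide)) (m (by decide)), le_inf (m (by decide)) (m (by decide))⟩),
     ⟨F.1 o t t o, sup_le (m (by decide)) (m (by decide)), le_inf (m (by decide)) (m (by decide))⟩),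
     ⟨F.1 o t o t, sup_le (m (by decide)) (m (by decide)), le_inf (m (by decide)) (m (by decide))⟩),
     ⟨F.1 o o t t, sup_le (m (by decide)) (m (by decide)), le_inf (m (by decide)) (m (by decide))⟩)⟩
  invFun := fun ⟨p, a, b, c, e, abc, abe, ace, bce, (((((ab, ac), ae), bc), be), ce)⟩ =>
    ⟨pick p.1.1 a.1 b.1 c.1 e.1 ab.1 ac.1 ae.1 bc.1 be.1 ce.1 abc.1 abe.1 ace.1 bce.1 p.1.2, by
      have h_a := a.2
      have h_b := b.2
      have h_c := c.2
      have h_e := e.2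
      have h_abc := abc.2
      have h_abe := abe.2
      have h_ace := ace.2
      have h_bce := bce.2
      have h_ab := ab.2
      have h_ac := ac.2
      have h_ae := ae.2
      have h_bc := bc.2
      have h_be := be.2
      have h_ce := ce.2
      simp only [Set.mem_Icc, sup_le_iff, le_inf_iff] at h_a h_b h_c h_e h_abc h_abe h_ace h_bce h_ab h_ac h_ae h_bc h_be h_ce
      simp only [Bool.forall_bool, pick, and_self, h_a, h_b, h_c, h_e, h_abc, h_abe, h_ace, h_bce, h_ab, h_ac, h_ae, h_bc, h_be, h_ce]⟩
  left_inv F := Subtype.ext (by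
    funext a b c e
    cases a <;> cases b <;> cases c <;> cases e <;> rfl)
  right_inv := by
    rintro ⟨⟨⟨x, y⟩, hxy⟩, ⟨a, ha⟩, ⟨b, hb⟩, ⟨c, hc⟩, ⟨e, he⟩, ⟨abc, habc⟩, ⟨abe, habe⟩,
      ⟨ace, hace⟩, ⟨bce, hbce⟩,
      ⟨⟨⟨⟨⟨⟨ab, hab⟩, ⟨ac, hac⟩⟩, ⟨ae, hae⟩⟩, ⟨bc, hbc⟩⟩, ⟨be, hbe⟩⟩, ⟨ce, hce⟩⟩⟩
    rfl

theorem dedekind_plus_four_second (n : ℕ) :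
    d (n + 4) =
      ∑ p : {p : D n × D n // p.1 ≤ p.2},
        ∑ a : Set.Icc p.val.1 p.val.2, ∑ b : Set.Icc p.val.1 p.val.2,
        ∑ c : Set.Icc p.val.1 p.val.2, ∑ dd : Set.Icc p.val.1 p.val.2,
          ∑ e : Set.Icc ((a : D n) ⊔ b ⊔ c) p.val.2,
          ∑ f : Set.Icc ((a : D n) ⊔ b ⊔ dd) p.val.2,
          ∑ g : Set.Icc ((a : D n) ⊔ c ⊔ dd) p.val.2,
          ∑ h : Set.Icc ((b : D n) ⊔ c ⊔ dd) p.val.2,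
            Nat.card (Set.Icc ((a : D n) ⊔ b) ((e : D n) ⊓ f)) *
            Nat.card (Set.Icc ((a : D n) ⊔ c) ((e : D n) ⊓ g)) *
            Nat.card (Set.Icc ((a : D n) ⊔ dd) ((f : D n) ⊓ g)) *
            Nat.card (Set.Icc ((b : D n) ⊔ c) ((e : D n) ⊓ h)) *
            Nat.card (Set.Icc ((b : D n) ⊔ dd) ((f : D n) ⊓ h)) *
            Nat.card (Set.Icc ((c : D n) ⊔ dd) ((g : D n) ⊓ h)) := by
  rw [d, Fintype.card_congr ((dedEquivM n).trans (dedMEquivS n))]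
  simp only [Fintype.card_sigma, Fintype.card_prod, Nat.card_eq_fintype_card]
end

section
/- For every natural number n, the (n+4)-th Dedekind number can be computed by traces of squared matrix products: d (n+4) = ∑_{(x,y) : D n × D n, x ≤ y} ∑_{a,b ∈ Set.Icc x y} Matrix.trace ((α_{a,b} * β_{a,b}) ^ 2), where for each interval [x, y] of D n and elements a, b of that interval, α_{a,b} and β_{a,b} are the square matrices with rows and columns indexed by the elements of Set.Icc x y and natural-number entries α_{a,b} c d = Nat.card (Set.Icc x (a ⊓ c ⊓ d)) · Nat.card (Set.Icc (b ⊔ c ⊔ d) y) and β_{a,b} c d = Nat.card (Set.Icc x (b ⊓ c ⊓ d)) · Nat.card (Set.Icc (a ⊔ c ⊔ d) y). -/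
noncomputable def splitEquiv (n : ℕ) : D (n + 4) ≃ ((Fin 4 → Bool) →o D n) where
  toFun f := ⟨fun s => ⟨fun t => f.1 (Fin.append t s), fun t t' h => f.2 (by
      intro i
      refine Fin.addCases (fun j => ?_) (fun j => ?_) i
      · simpa using h j
      · simp)⟩, fun s s' h t => f.2 (by
      intro i
      refine Fin.addCases (fun j => ?_) (fun j => ?_) i
      · simp
      · simpa using h j)⟩
  invFun G := ⟨fun u => (G (fun j => u (Fin.natAdd n j))).1 (fun j => u (Fin.castAdd 4 j)), by
    intro u u' h
    exact le_trans ((G _).2 (fun j => h _))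
      ((G.2 (fun j => h (Fin.natAdd n j)) : G _ ≤ G _) _)⟩
  left_inv f := by
    apply Subtype.ext
    funext u
    change f.1 _ = f.1 _
    refine congrArg f.1 (funext fun i => ?_)
    refine Fin.addCases (fun j => ?_) (fun j => ?_) i <;> simp
  right_inv G := by
    apply OrderHom.ext
    funext s
    apply Subtype.ext
    funext t
    change (G _).1 _ = (G _).1 _
    simp

abbrev Big (L : Type) [Lattice L] : Type :=
  Σ p : {p : L × L // p.1 ≤ p.2}, Σ a : Set.Icc p.1.1 p.1.2, Σ b : Set.Icc p.1.1 p.1.2,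
  Σ c1 : Set.Icc p.1.1 p.1.2, Σ c3 : Set.Icc p.1.1 p.1.2,
  Σ c2 : Set.Icc p.1.1 p.1.2, Σ c4 : Set.Icc p.1.1 p.1.2,
    ((Set.Icc p.1.1 (a.1 ⊓ c1.1 ⊓ c2.1) × Set.Icc (b.1 ⊔ c1.1 ⊔ c2.1) p.1.2) ×
     (Set.Icc p.1.1 (b.1 ⊓ c2.1 ⊓ c3.1) × Set.Icc (a.1 ⊔ c2.1 ⊔ c3.1) p.1.2)) ×
    ((Set.Icc p.1.1 (a.1 ⊓ c3.1 ⊓ c4.1) × Set.Icc (b.1 ⊔ c3.1 ⊔ c4.1) p.1.2) ×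
     (Set.Icc p.1.1 (b.1 ⊓ c4.1 ⊓ c1.1) × Set.Icc (a.1 ⊔ c4.1 ⊔ c1.1) p.1.2))

def sel {L : Type} (x y a b c1 c2 c3 c4 t1 t2 t3 t4 u123 u124 u134 u234 : L) :
    Bool → Bool → Bool → Bool → L
  | false, false, false, false => x
  | true, false, false, false => t1
  | false, true, false, false => t2
  | false, false, true, false => t3
  | false, false, false, true => t4
  | true, true, false, false => a
  | false, false, true, true => b
  | true, false, true, false => c1
  | true, false, false, true => c2
  | false, true, false, true => c3
  | false, true, true, false => c4
  | true, true, true, false => u123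
  | true, true, false, true => u124
  | true, false, true, true => u134
  | false, true, true, true => u234
  | true, true, true, true => y

theorem mono4 {L : Type} [Preorder L] (g : Bool → Bool → Bool → Bool → L)
    (h1 : ∀ q r s, g false q r s ≤ g true q r s)
    (h2 : ∀ p r s, g p false r s ≤ g p true r s)
    (h3 : ∀ p q s, g p q false s ≤ g p q true s)
    (h4 : ∀ p q r, g p q r false ≤ g p q r true) :
    Monotone (fun v : Fin 4 → Bool => g (v 0) (v 1) (v 2) (v 3)) := by
  have key : ∀ k : Bool → L, k false ≤ k true → ∀ p q, p ≤ q → k p ≤ k q := by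
    intro k hk p q hpq
    cases p <;> cases q <;> first | exact le_rfl | exact hk | exact absurd hpq (by decide)
  intro v w h
  exact (key (fun p => g p _ _ _) (h1 _ _ _) _ _ (h 0)).trans <|
    (key (fun p => g _ p _ _) (h2 _ _ _) _ _ (h 1)).trans <|
    (key (fun p => g _ _ p _) (h3 _ _ _) _ _ (h 2)).trans <|
    (key (fun p => g _ _ _ p) (h4 _ _ _) _ _ (h 3))

def bigInv {L : Type} [Lattice L] : Big L → ((Fin 4 → Bool) →o L)
  | ⟨⟨⟨x, y⟩, hxy⟩, ⟨a, ha⟩, ⟨b, hb⟩, ⟨c1, hc1⟩, ⟨c3, hc3⟩, ⟨c2, hc2⟩, ⟨c4, hc4⟩,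
      ((⟨t1, ht1⟩, ⟨u134, hu134⟩), (⟨t4, ht4⟩, ⟨u124, hu124⟩)),
      ((⟨t2, ht2⟩, ⟨u234, hu234⟩), (⟨t3, ht3⟩, ⟨u123, hu123⟩))⟩ =>
    ⟨fun v => sel x y a b c1 c2 c3 c4 t1 t2 t3 t4 u123 u124 u134 u234 (v 0) (v 1) (v 2) (v 3), by
      simp only [Set.mem_Icc, le_inf_iff, sup_le_iff] at *
      apply mono4 <;> intro p q r <;> cases p <;> cases q <;> cases r <;> simp only [sel] <;> tauto⟩

def bigEquiv (L : Type) [Lattice L] : ((Fin 4 → Bool) →o L) ≃ Big L where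
  toFun G :=
    have H : ∀ {v w : Fin 4 → Bool}, (∀ i, v i ≤ w i) → G v ≤ G w := fun h => G.2 h
    let z : Fin 4 → Bool := ![false, false, false, false]
    let o : Fin 4 → Bool := ![true, true, true, true]
    have I : ∀ v, G v ∈ Set.Icc (G z) (G o) := fun v =>
      ⟨H (by intro i; fin_cases i <;> exact Bool.false_le _),
       H (by intro i; fin_cases i <;> exact Bool.le_true _)⟩
    ⟨⟨(G z, G o), H (by decide)⟩,
     ⟨G ![true, true, false, false], I _⟩, ⟨G ![false, false, true, true], I _⟩,
     ⟨G ![true, false, true, false], I _⟩, ⟨G ![false, true, false, true], I _⟩,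
     ⟨G ![true, false, false, true], I _⟩, ⟨G ![false, true, true, false], I _⟩,
     ((⟨G ![true, false, false, false], (I _).1,
          le_inf (le_inf (H (by decide)) (H (by decide))) (H (by decide))⟩,
       ⟨G ![true, false, true, true],
          sup_le (sup_le (H (by decide)) (H (by decide))) (H (by decide)), (I _).2⟩),
      (⟨G ![false, false, false, true], (I _).1,
          le_inf (le_inf (H (by decide)) (H (by decide))) (H (by decide))⟩,
       ⟨G ![true, true, false, true],
          sup_le (sup_le (H (by decide)) (H (by decide))) (H (by decide)), (I _).2⟩)),
     ((⟨G ![false, true, false, false], (I _).1,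
          le_inf (le_inf (H (by decide)) (H (by decide))) (H (by decide))⟩,
       ⟨G ![false, true, true, true],
          sup_le (sup_le (H (by decide)) (H (by decide))) (H (by decide)), (I _).2⟩),
      (⟨G ![false, false, true, false], (I _).1,
          le_inf (le_inf (H (by decide)) (H (by decide))) (H (by decide))⟩,
       ⟨G ![true, true, true, false],
          sup_le (sup_le (H (by decide)) (H (by decide))) (H (by decide)), (I _).2⟩))⟩
  invFun := bigInv
  left_inv G := by
    apply OrderHom.ext
    funext v
    have hv : v = ![v 0, v 1, v 2, v 3] := by
      funext i; fin_cases i <;> rfl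
    rw [hv]
    generalize v 0 = p
    generalize v 1 = q
    generalize v 2 = r
    generalize v 3 = s
    cases p <;> cases q <;> cases r <;> cases s <;> rfl
  right_inv := by
    rintro ⟨⟨⟨x, y⟩, hxy⟩, ⟨a, ha⟩, ⟨b, hb⟩, ⟨c1, hc1⟩, ⟨c3, hc3⟩, ⟨c2, hc2⟩, ⟨c4, hc4⟩,
      ⟨⟨⟨t1, ht1⟩, ⟨u134, hu134⟩⟩, ⟨⟨t4, ht4⟩, ⟨u124, hu124⟩⟩⟩,
      ⟨⟨⟨t2, ht2⟩, ⟨u234, hu234⟩⟩, ⟨⟨t3, ht3⟩, ⟨u123, hu123⟩⟩⟩⟩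
    rfl

theorem dedekind_plus_four_matrix (n : ℕ) :
    d (n + 4) =
      ∑ p : {p : D n × D n // p.1 ≤ p.2},
        ∑ a : Set.Icc p.val.1 p.val.2, ∑ b : Set.Icc p.val.1 p.val.2,
          Matrix.trace
            (((Matrix.of fun c dd : Set.Icc p.val.1 p.val.2 =>
                  Nat.card (Set.Icc p.val.1 ((a : D n) ⊓ c ⊓ dd)) *
                  Nat.card (Set.Icc ((b : D n) ⊔ c ⊔ dd) p.val.2)) *
              (Matrix.of fun c dd : Set.Icc p.val.1 p.val.2 =>
                  Nat.card (Set.Icc p.val.1 ((b : D n) ⊓ c ⊓ dd)) *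
                  Nat.card (Set.Icc ((a : D n) ⊔ c ⊔ dd) p.val.2))) ^ 2) := by
  have e : d (n + 4) = Nat.card (Big (D n)) := by
    rw [d, ← Nat.card_eq_fintype_card]
    exact Nat.card_congr ((splitEquiv n).trans (bigEquiv (D n)))
  rw [e]
  simp only [Big, Nat.card_sigma, Nat.card_prod]
  refine Finset.sum_congr rfl fun p _ => Finset.sum_congr rfl fun a _ =>
    Finset.sum_congr rfl fun b _ => ?_
  simp only [pow_two, Matrix.trace, Matrix.diag_apply, Matrix.mul_apply, Matrix.of_apply,
    Finset.sum_mul_sum]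
end
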